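/- Let n ≥ 1 be an integer and let f₁,…,f_n : ℝ → ℝ be n continuous functions satisfying: (b) for each k = 1,…,n, limsup_{|t|→+∞} |∫₀ᵗ f_k(s)ds| / t² < +∞; (c) for each k = 1,…,n, the function t ↦ ∫₀ᵗ f_k(s)ds is odd and vanishes only at 0. Then, for each a > 0, r > 0 and b < 0, there exists δ > 0 with the following property: for every n-tuple of continuous functions g₁,…,g_n : ℝ → ℝ satisfying max_{1≤k≤n} ( sup_{t∈ℝ} ∫₀ᵗ g_k(s)ds − inf_{t∈ℝ} ∫₀ᵗ g_k(s)ds ) < δ, there exists (μ̃₁,…,μ̃_n) ∈ ℝⁿ with Σ_{k=1}^n |μ̃_k|² < r², such that the problem −(a Σ_{h=1}^{n+1} |x_h − x_{h−1}|² + b)(x_{k+1} − 2x_k + x_{k−1}) = g_k(x_k) + μ̃_k f_k(x_k) for k = 1,…,n, with x₀ = x_{n+1} = 0, has at least three solutions. -/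

import Mathlib

open Filter InnerProductSpace Topology

/-- A coercive `C¹` function with two distinct global minimizers has a third critical point. -/
theorem exists_third_critical_point {E : Type*} [NormedAddCommGroup E] [InnerProductSpace ℝ E]
    [ProperSpace E] {J : E → ℝ} {G : E → E} (hJ : ∀ x, HasGradientAt J (G x) x)
    (hG : Continuous G) (hco : Tendsto J (cocompact E) atTop) {x₀ x₁ : E} (hne : x₀ ≠ x₁)
    (h₀ : ∀ y, J x₀ ≤ J y) (h₁ : ∀ y, J x₁ ≤ J y) :
    ∃ x, x ≠ x₀ ∧ x ≠ x₁ ∧ G x = 0 := by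
  have hcont : Continuous J := continuous_iff_continuousAt.2 fun x => (hJ x).continuousAt
  have hmin : ∀ z, (∀ y, J z ≤ J y) → G z = 0 := fun z hz => by
    have := IsLocalMin.hasFDerivAt_eq_zero (f := J) (a := z) (Eventually.of_forall hz)
      (hJ z).hasFDerivAt
    simpa using this
  by_contra! hcrit
  have hsub : ∀ s, IsCompact {x | J x ≤ s} := fun s => by
    obtain ⟨K, hK, hKs⟩ := mem_cocompact.1 (hco.eventually_gt_atTop s)
    refine hK.of_isClosed_subset (isClosed_le hcont continuous_const) fun x hx => ?_
    by_contra hxK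
    have hlt : s < J x := hKs hxK
    exact hlt.not_ge hx
  have hd : 0 < dist x₀ x₁ := dist_pos.2 hne
  obtain ⟨m', hm', hsphere⟩ := (isCompact_sphere x₀ (dist x₀ x₁ / 2)).exists_forall_le'
    (a := J x₀) hcont.continuousOn fun x hx => by
      refine lt_of_le_of_ne (h₀ x) fun heq => ?_
      rw [Metric.mem_sphere] at hx
      refine hcrit x ?_ ?_ (hmin x fun y => heq ▸ h₀ y)
      · rintro rfl
        rw [dist_self] at hx; linarith
      · rintro rfl
        rw [dist_comm] at hx; linarith
  let A : Set ℝ := {s | ∃ K : Set E, IsPreconnected K ∧ x₀ ∈ K ∧ x₁ ∈ K ∧ ∀ x ∈ K, J x ≤ s}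
  have hAlow : ∀ s ∈ A, m' ≤ s := by
    rintro s ⟨K, hK, hx₀, hx₁, hKs⟩
    obtain ⟨z, hzK, hz⟩ := hK.intermediate_value hx₀ hx₁
      (f := fun x => dist x x₀) (by fun_prop)
      (show dist x₀ x₁ / 2 ∈ Set.Icc (dist x₀ x₀) (dist x₁ x₀) by
        rw [dist_self, dist_comm x₁]; constructor <;> linarith)
    exact (hsphere z hz).trans (hKs z hzK)
  have hAne : A.Nonempty := by
    have hseg : IsCompact (segment ℝ x₀ x₁) := by
      rw [segment_eq_image_lineMap]
      exact isCompact_Icc.image AffineMap.lineMap_continuous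
    obtain ⟨s, hs⟩ := (hseg.image hcont).bddAbove
    exact ⟨s, _, (convex_segment x₀ x₁).isPreconnected, left_mem_segment ℝ x₀ x₁,
      right_mem_segment ℝ x₀ x₁, fun x hx => hs ⟨x, hx, rfl⟩⟩
  have hAbdd : BddBelow A := ⟨m', hAlow⟩
  set c := sInf A with hc
  have hmc : J x₀ < c := hm'.trans_le (le_csInf hAne hAlow)
  set l := (c + J x₀) / 2 with hl
  have hQ := hsub (c + 1)
  obtain ⟨B, hB⟩ := hQ.exists_bound_of_continuousOn hG.continuousOn
  obtain ⟨κ, hκ, hκG⟩ := (hQ.inter_right (isClosed_le continuous_const hcont :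
    IsClosed {x | l ≤ J x})).exists_forall_le' (a := 0) (f := fun x => ‖G x‖)
    hG.norm.continuousOn fun x hx => by
      refine norm_pos_iff.2 fun h0 => ?_
      have hlx : l ≤ J x := hx.2
      refine hcrit x ?_ ?_ h0
      · rintro rfl
        linarith
      · rintro rfl
        linarith [h₁ x₀]
  obtain ⟨η, hη, hηG⟩ := Metric.mem_uniformity_dist.1 <|
    hQ.uniformContinuousAt_of_continuousAt G (fun x _ => hG.continuousAt)
      (Metric.dist_mem_uniformity (half_pos hκ))
  obtain ⟨θ, hθ, hθJ⟩ := Metric.mem_uniformity_dist.1 <|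
    hQ.uniformContinuousAt_of_continuousAt J (fun x _ => hcont.continuousAt)
      (Metric.dist_mem_uniformity (show 0 < (c - l) / 2 by linarith))
  have hB' : 0 < |B| + 1 := by positivity
  set t := min η θ / (2 * (|B| + 1)) with ht
  have htpos : 0 < t := by positivity
  have hstep : ∀ x, J x ≤ c + 1 → t * ‖G x‖ < min η θ := fun x hx => by
    have h1 : t * ‖G x‖ ≤ t * (|B| + 1) :=
      mul_le_mul_of_nonneg_left (by linarith [hB x hx, le_abs_self B]) htpos.le
    have h2 : t * (|B| + 1) = min η θ / 2 := by rw [ht]; field_simp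
    have h3 : 0 < min η θ := lt_min hη hθ
    linarith
  have hdesc : ∀ x, J x ≤ c + 1 → l ≤ J x → J (x - t • G x) ≤ J x - t * κ ^ 2 / 2 := by
    intro x hx hlx
    have hκx : κ ≤ ‖G x‖ := hκG x ⟨hx, hlx⟩
    have key := (convex_ball x η).norm_image_sub_le_of_norm_hasFDerivWithin_le'
      (f := J) (f' := fun y => toDual ℝ E (G y)) (φ := toDual ℝ E (G x)) (C := κ / 2)
      (x := x) (y := x - t • G x) (fun y _ => (hJ y).hasFDerivAt.hasFDerivWithinAt)
      (fun y hy => by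
        rw [← map_sub, LinearIsometryEquiv.norm_map, ← dist_eq_norm, dist_comm]
        exact (hηG (by rwa [dist_comm]) hx).le)
      (Metric.mem_ball_self hη) (by
        rw [Metric.mem_ball, dist_eq_norm, sub_sub_cancel_left, norm_neg, norm_smul,
          Real.norm_of_nonneg htpos.le]
        exact (hstep x hx).trans_le (min_le_left _ _))
    rw [sub_sub_cancel_left, norm_neg, norm_smul, Real.norm_of_nonneg htpos.le, map_neg, map_smul,
      toDual_apply_apply, real_inner_self_eq_norm_sq, Real.norm_eq_abs, smul_eq_mul] at key
    have h1 := (abs_le.1 key).2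
    have h2 : t * κ ^ 2 ≤ t * ‖G x‖ ^ 2 := by gcongr
    have h3 : κ / 2 * (t * ‖G x‖) ≤ t * ‖G x‖ ^ 2 / 2 := by
      have : t * ‖G x‖ * κ ≤ t * ‖G x‖ * ‖G x‖ := by gcongr
      nlinarith
    linarith
  obtain ⟨s, ⟨K, hK, hK₀, hK₁, hKs⟩, hs⟩ := exists_lt_of_csInf_lt hAne
    (show sInf A < c + min 1 (t * κ ^ 2 / 4) by
      rw [← hc]; exact lt_add_of_pos_right _ (by positivity))
  have hs1 : s < c + 1 := hs.trans_le (by gcongr; exact min_le_left _ _)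
  have hs2 : s < c + t * κ ^ 2 / 4 := hs.trans_le (by gcongr; exact min_le_right _ _)
  have htκ : 0 < t * κ ^ 2 := by positivity
  have hmem : max (c - t * κ ^ 2 / 4) ((c + l) / 2) ∈ A := by
    refine ⟨(fun x => x - t • G x) '' K, hK.image _ (by fun_prop), ⟨x₀, hK₀, ?_⟩,
      ⟨x₁, hK₁, ?_⟩, ?_⟩
    · simp [hmin x₀ h₀]
    · simp [hmin x₁ h₁]
    · rintro _ ⟨x, hx, rfl⟩
      have hxs := hKs x hx
      have hxQ : J x ≤ c + 1 := by linarith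
      rcases le_or_gt l (J x) with hlx | hlx
      · exact le_max_of_le_left (by linarith [hdesc x hxQ hlx])
      · refine le_max_of_le_right ?_
        have := hθJ (a := x) (b := x - t • G x) (by
          rw [dist_eq_norm, sub_sub_cancel, norm_smul, Real.norm_of_nonneg htpos.le]
          exact (hstep x hxQ).trans_le (min_le_right _ _)) hxQ
        have h := (abs_lt.1 (show |J x - J (x - t • G x)| < (c - l) / 2 from this)).1
        simp only
        linarith
  have := csInf_le hAbdd hmem
  rw [← hc] at this
  have : max (c - t * κ ^ 2 / 4) ((c + l) / 2) < c := max_lt (by linarith) (by linarith)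
  linarith

/-- If the minimum of `x ↦ I x - ∑ μ_k F_k x` stays below `c` for every `μ` in the box `|μ_k| ≤ ρ`,
while its supremum over the box is at least `c` at every `x`, then for some `μ` in the box there are
two distinct global minimizers. -/
theorem exists_two_minimizers_of_minimax_gap {X ι : Type*} [MetricSpace X] [Fintype ι]
    {I Ψ : X → ℝ} {F : ι → X → ℝ} {ρ c : ℝ} (hI : Continuous I) (hF : ∀ k, Continuous (F k))
    (hρ : 0 ≤ ρ) (hΨ : Tendsto Ψ (cocompact X) atTop)
    (hΨle : ∀ μ : ι → ℝ, (∀ k, |μ k| ≤ ρ) → ∀ x, Ψ x ≤ I x - ∑ k, μ k * F k x)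
    (hlow : ∀ x, c ≤ I x + ρ * ∑ k, |F k x|)
    (hup : ∀ μ : ι → ℝ, (∀ k, |μ k| ≤ ρ) → ∃ x, I x - ∑ k, μ k * F k x < c) :
    ∃ μ : ι → ℝ, (∀ k, |μ k| ≤ ρ) ∧ ∃ x₀ x₁, x₀ ≠ x₁ ∧
      (∀ y, I x₀ - ∑ k, μ k * F k x₀ ≤ I y - ∑ k, μ k * F k y) ∧
      ∀ y, I x₁ - ∑ k, μ k * F k x₁ ≤ I y - ∑ k, μ k * F k y := by
  set L : (ι → ℝ) → X → ℝ := fun μ x => I x - ∑ k, μ k * F k x with hL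
  have hLcont : Continuous fun p : (ι → ℝ) × X => L p.1 p.2 := by fun_prop
  obtain ⟨K, hK, hKc⟩ := mem_cocompact.1 (hΨ.eventually_gt_atTop c)
  have hKmem : ∀ μ : ι → ℝ, (∀ k, |μ k| ≤ ρ) → ∀ x, L μ x ≤ c → x ∈ K := fun μ hμ x hx => by
    by_contra hxK
    have : c < Ψ x := hKc hxK
    exact (this.trans_le (hΨle μ hμ x)).not_ge hx
  have hmin : ∀ μ : ι → ℝ, (∀ k, |μ k| ≤ ρ) →
      ∃ x ∈ K, (∀ y, L μ x ≤ L μ y) ∧ sInf (L μ '' K) = L μ x := fun μ hμ => by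
    obtain ⟨z, hz⟩ := hup μ hμ
    have hzK := hKmem μ hμ z hz.le
    obtain ⟨x, hxK, hx, hxmin⟩ := hK.exists_sInf_image_eq_and_le ⟨z, hzK⟩
      (f := L μ) (by fun_prop)
    refine ⟨x, hxK, fun y => ?_, hx⟩
    by_cases hy : y ∈ K
    · exact hxmin y hy
    · have : ¬ L μ y ≤ c := fun h => hy (hKmem μ hμ y h)
      linarith [hxmin z hzK]
  have hbox : IsCompact {μ : ι → ℝ | ∀ k, |μ k| ≤ ρ} := by
    convert isCompact_univ_pi fun _ : ι => isCompact_Icc (a := -ρ) (b := ρ) using 1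
    ext μ; simp only [abs_le, Set.mem_ofPred_eq, Set.mem_univ_pi, Set.mem_Icc]
  obtain ⟨μ, hμ, hμmax⟩ := hbox.exists_isMaxOn ⟨0, fun k => by simpa using hρ⟩
    (hK.continuous_sInf (f := L) hLcont).continuousOn
  refine ⟨μ, hμ, ?_⟩
  obtain ⟨x, hxK, hxmin, hx⟩ := hmin μ hμ
  by_contra! huniq
  have hunique : ∀ y, (∀ z, L μ y ≤ L μ z) → y = x := fun y hy => by
    by_contra hne
    obtain ⟨z, hz⟩ := huniq x y (Ne.symm hne) hxmin
    exact hz.not_ge (hy z)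
  -- the extremal multiplier in the direction opposite to the values at the minimizer
  set ν : ι → ℝ := fun k => -ρ * SignType.sign (F k x) with hν
  have hνF : ∀ k, ν k * F k x = -(ρ * |F k x|) := fun k => by
    rw [hν, ← sign_mul_self (F k x)]; ring
  have hνbox : ∀ k, |ν k| ≤ ρ := fun k => by
    rw [hν, abs_mul, abs_neg, abs_of_nonneg hρ]
    refine mul_le_of_le_one_right hρ ?_
    rcases lt_trichotomy (F k x) 0 with h | h | h <;> simp [h]
  set t : ℕ → ℝ := fun m => 1 / ((m : ℝ) + 1) with ht
  have htpos : ∀ m, 0 < t m := fun m => by positivity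
  have htle : ∀ m, t m ≤ 1 := fun m => by
    rw [ht]; exact div_le_one_of_le₀ (by simp) (by positivity)
  set w : ℕ → ι → ℝ := fun m k => μ k + t m * (ν k - μ k) with hw
  have hwbox : ∀ m k, |w m k| ≤ ρ := fun m k => by
    have h1 := abs_le.1 (hμ k)
    have h2 := abs_le.1 (hνbox k)
    have h3 := htpos m
    have h4 := htle m
    rw [hw, abs_le]
    constructor <;> nlinarith
  have hwlim : Tendsto w atTop (𝓝 μ) := by
    refine tendsto_pi_nhds.2 fun k => ?_
    have := (tendsto_one_div_add_atTop_nhds_zero_nat (𝕜 := ℝ)).mul_const (ν k - μ k)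
    simpa only [zero_mul, add_zero] using this.const_add (μ k)
  choose z hzK hzmin hz using fun m => hmin (w m) (hwbox m)
  obtain ⟨x', -, φ, hφ, hlim⟩ := hK.tendsto_subseq hzK
  have hwφ := hwlim.comp hφ.tendsto_atTop
  have hx' : x' = x := hunique x' fun y => by
    refine le_of_tendsto_of_tendsto' ((hLcont.tendsto (μ, x')).comp (hwφ.prodMk_nhds hlim))
      ((hLcont.tendsto (μ, y)).comp (hwφ.prodMk_nhds tendsto_const_nhds)) fun m => ?_
    exact hzmin (φ m) y
  subst hx'
  have hdir : ∀ m, 0 ≤ ∑ k, (ν k - μ k) * F k (z m) := fun m => by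
    have h1 : L (w m) (z m) = L μ (z m) - t m * ∑ k, (ν k - μ k) * F k (z m) := by
      simp only [hL, hw, add_mul, Finset.sum_add_distrib, Finset.mul_sum, mul_assoc]
      ring
    have h2 : L (w m) (z m) ≤ L μ x' := by
      rw [← hz, ← hx]; exact hμmax (hwbox m)
    have h3 := hxmin (z m)
    have : 0 ≤ t m * ∑ k, (ν k - μ k) * F k (z m) := by linarith
    exact nonneg_of_mul_nonneg_right this (htpos m)
  have hdir' : 0 ≤ ∑ k, (ν k - μ k) * F k x' :=
    ge_of_tendsto' (((show Continuous fun y => ∑ k, (ν k - μ k) * F k y by fun_prop).tendsto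
      x').comp hlim) fun m => hdir (φ m)
  simp only [sub_mul, Finset.sum_sub_distrib, hνF, Finset.sum_neg_distrib, ← Finset.mul_sum]
    at hdir'
  obtain ⟨y, hy⟩ := hup μ hμ
  have := hxmin y
  have := hlow x'
  simp only [hL] at *
  linarith

/-- The coordinates of the extension of `x : ℝⁿ` by zero to the nodes `0, …, n + 1`. -/
noncomputable def zeroExtend {n : ℕ} : Fin (n + 2) → EuclideanSpace ℝ (Fin n) →L[ℝ] ℝ :=
  Fin.cons 0 (Fin.snoc (α := fun _ => EuclideanSpace ℝ (Fin n) →L[ℝ] ℝ)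
    (fun k => EuclideanSpace.proj k) 0)

section ZeroExtend

variable {n : ℕ} (x : EuclideanSpace ℝ (Fin n))

@[simp] theorem zeroExtend_zero : zeroExtend 0 x = 0 := by simp [zeroExtend]

@[simp] theorem zeroExtend_last : zeroExtend (Fin.last (n + 1)) x = 0 := by
  rw [← Fin.succ_last, zeroExtend, Fin.cons_succ, Fin.snoc_last]; rfl

@[simp] theorem zeroExtend_castSucc_succ (k : Fin n) : zeroExtend k.castSucc.succ x = x k := by
  rw [zeroExtend, Fin.cons_succ, Fin.snoc_castSucc]; rfl

theorem zeroExtend_succ_castSucc (k : Fin n) : zeroExtend k.succ.castSucc x = x k := by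
  rw [← Fin.succ_castSucc, zeroExtend_castSucc_succ]

/-- The discrete Dirichlet energy `∑ |x_h - x_{h-1}|²`. -/
noncomputable def dirichletEnergy : ℝ :=
  ∑ h : Fin (n + 1), (zeroExtend h.succ x - zeroExtend h.castSucc x) ^ 2

/-- The discrete Laplacian `x_{k+1} - 2 x_k + x_{k-1}`. -/
noncomputable def discreteLaplacian (k : Fin n) : ℝ :=
  zeroExtend k.succ.succ x - 2 * zeroExtend k.succ.castSucc x + zeroExtend k.castSucc.castSucc x

theorem sum_mul_diff_eq (p : Fin (n + 1) → ℝ) (q : Fin (n + 2) → ℝ) (hq₀ : q 0 = 0)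
    (hq₁ : q (Fin.last (n + 1)) = 0) :
    ∑ h, p h * (q h.succ - q h.castSucc) =
      ∑ k : Fin n, (p k.castSucc - p k.succ) * q k.castSucc.succ := by
  simp only [mul_sub, Finset.sum_sub_distrib, sub_mul]
  rw [Fin.sum_univ_castSucc, Fin.sum_univ_succ (fun i => p i * q i.castSucc)]
  simp [hq₀, hq₁]

theorem dirichletEnergy_nonneg : 0 ≤ dirichletEnergy x :=
  Finset.sum_nonneg fun _ _ => sq_nonneg _

theorem dirichletEnergy_smul (s : ℝ) :
    dirichletEnergy (s • x) = s ^ 2 * dirichletEnergy x := by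
  simp only [dirichletEnergy, map_smul, smul_eq_mul, Finset.mul_sum]
  exact Finset.sum_congr rfl fun _ _ => by ring

theorem continuous_dirichletEnergy : Continuous (dirichletEnergy (n := n)) := by
  unfold dirichletEnergy; fun_prop

theorem continuous_discreteLaplacian (k : Fin n) :
    Continuous fun x : EuclideanSpace ℝ (Fin n) => discreteLaplacian x k := by
  unfold discreteLaplacian; fun_prop

theorem abs_zeroExtend_le (j : Fin (n + 2)) :
    |zeroExtend j x| ≤ (j : ℕ) * √(dirichletEnergy x) := by
  induction j using Fin.induction with
  | zero => simp
  | succ j ih =>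
    have h : |zeroExtend j.succ x - zeroExtend j.castSucc x| ≤ √(dirichletEnergy x) := by
      refine Real.abs_le_sqrt ?_
      exact Finset.single_le_sum
        (f := fun h : Fin (n + 1) => (zeroExtend h.succ x - zeroExtend h.castSucc x) ^ 2)
        (fun _ _ => sq_nonneg _) (Finset.mem_univ j)
    have h' := abs_add_le (zeroExtend j.succ x - zeroExtend j.castSucc x) (zeroExtend j.castSucc x)
    rw [sub_add_cancel] at h'
    rw [Fin.val_castSucc] at ih
    rw [Fin.val_succ]
    push_cast
    linarith

theorem sq_apply_le_dirichletEnergy (k : Fin n) :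
    x k ^ 2 ≤ ((n : ℝ) + 1) ^ 2 * dirichletEnergy x := by
  have h := abs_zeroExtend_le x k.castSucc.succ
  rw [zeroExtend_castSucc_succ] at h
  have hk : ((k.castSucc.succ : Fin (n + 2)) : ℝ) ≤ (n : ℝ) + 1 := by
    have := k.castSucc.succ.is_le
    exact_mod_cast this
  have h' : |x k| ≤ ((n : ℝ) + 1) * √(dirichletEnergy x) := h.trans (by gcongr)
  have := pow_le_pow_left₀ (abs_nonneg _) h' 2
  rwa [sq_abs, mul_pow, Real.sq_sqrt (dirichletEnergy_nonneg x)] at this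

theorem norm_sq_le_dirichletEnergy :
    ‖x‖ ^ 2 ≤ n * ((n : ℝ) + 1) ^ 2 * dirichletEnergy x := by
  rw [EuclideanSpace.real_norm_sq_eq]
  refine (Finset.sum_le_sum fun k _ => sq_apply_le_dirichletEnergy x k).trans_eq ?_
  simp [mul_assoc]

theorem tendsto_dirichletEnergy :
    Tendsto (dirichletEnergy (n := n)) (cocompact _) atTop := by
  have h : Tendsto (fun x : EuclideanSpace ℝ (Fin n) => ‖x‖ ^ 2) (cocompact _) atTop :=
    (tendsto_pow_atTop two_ne_zero).comp tendsto_norm_cocompact_atTop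
  have hn : 0 < n * ((n : ℝ) + 1) ^ 2 + 1 := by positivity
  refine tendsto_atTop_mono (fun x => ?_) (h.atTop_div_const hn)
  rw [div_le_iff₀ hn]
  nlinarith [norm_sq_le_dirichletEnergy x, dirichletEnergy_nonneg x]

theorem hasGradientAt_dirichletEnergy :
    HasGradientAt dirichletEnergy (WithLp.toLp 2 fun k => -2 * discreteLaplacian x k) x := by
  have h : HasFDerivAt (dirichletEnergy (n := n))
      (∑ h : Fin (n + 1), (2 * (zeroExtend h.succ x - zeroExtend h.castSucc x)) •
        (zeroExtend h.succ - zeroExtend h.castSucc)) x := by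
    refine HasFDerivAt.fun_sum fun h _ => ?_
    simpa using ((zeroExtend h.succ - zeroExtend h.castSucc).hasFDerivAt (x := x)).pow 2
  refine hasGradientAt_iff_hasFDerivAt.2 (h.congr_fderiv ?_)
  ext1 v
  rw [toDual_apply_apply, PiLp.inner_apply]
  have := sum_mul_diff_eq (fun h => 2 * (zeroExtend h.succ x - zeroExtend h.castSucc x))
    (fun j => zeroExtend j v) (zeroExtend_zero v) (zeroExtend_last v)
  simp only [_root_.sum_apply, _root_.smul_apply,
    _root_.sub_apply, smul_eq_mul, this]
  refine Finset.sum_congr rfl fun k _ => ?_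
  simp only [discreteLaplacian, zeroExtend_castSucc_succ, zeroExtend_succ_castSucc,
    RCLike.inner_apply, conj_trivial]
  ring

end ZeroExtend

theorem Filter.Tendsto.quadratic_atTop {α : Type*} {l : Filter α} {S : α → ℝ}
    (hS : Tendsto S l atTop) {p : ℝ} (hp : 0 < p) (q C : ℝ) :
    Tendsto (fun x => p * S x ^ 2 + q * S x - C) l atTop := by
  refine tendsto_atTop_mono (fun x => ?_) (tendsto_atTop_add_const_right l
    (-((1 - q) ^ 2 / (4 * p)) - C) hS)
  have h : p * S x ^ 2 + q * S x - C - (S x + (-((1 - q) ^ 2 / (4 * p)) - C)) =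
      p * (S x - (1 - q) / (2 * p)) ^ 2 := by
    field_simp; ring
  have : 0 ≤ p * (S x - (1 - q) / (2 * p)) ^ 2 := by positivity
  linarith

theorem exists_abs_le_mul_sq_add_one {F : ℝ → ℝ} (hF : Continuous F)
    (hb : limsup (fun t : ℝ => ((|F t| / t ^ 2 : ℝ) : EReal)) (atBot ⊔ atTop) < ⊤) :
    ∃ C, 0 ≤ C ∧ ∀ t, |F t| ≤ C * (t ^ 2 + 1) := by
  obtain ⟨c, hc, -⟩ := EReal.lt_iff_exists_real_btwn.1 hb
  have hev := eventually_lt_of_limsup_lt hc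
  rw [eventually_sup] at hev
  obtain ⟨u, hu⟩ := eventually_atBot.1 hev.1
  obtain ⟨v, hv⟩ := eventually_atTop.1 hev.2
  obtain ⟨B, hB⟩ := (isCompact_Icc (a := min u (-1)) (b := max v 1)).exists_bound_of_continuousOn
    hF.continuousOn
  refine ⟨|c| + |B|, by positivity, fun t => ?_⟩
  have key : ∀ t : ℝ, t ≠ 0 → ((|F t| / t ^ 2 : ℝ) : EReal) < c →
      |F t| ≤ (|c| + |B|) * (t ^ 2 + 1) := fun t ht h => by
    have h' := EReal.coe_lt_coe_iff.1 h
    rw [div_lt_iff₀ (by positivity)] at h'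
    nlinarith [le_abs_self c, abs_nonneg c, abs_nonneg B, sq_nonneg t]
  rcases lt_or_ge t (min u (-1)) with h | h
  · exact key t (by linarith [min_le_right u (-1)]) (hu t (h.le.trans (min_le_left _ _)))
  rcases lt_or_ge (max v 1) t with h' | h'
  · exact key t (by linarith [le_max_right v 1]) (hv t ((le_max_left _ _).trans h'.le))
  · have := hB t ⟨h, h'⟩
    rw [Real.norm_eq_abs] at this
    nlinarith [le_abs_self B, abs_nonneg c, abs_nonneg B, sq_nonneg t]

theorem abs_lt_of_iSup_sub_iInf_lt {G : ℝ → ℝ} {δ : ℝ} (h0 : G 0 = 0)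
    (ha : BddAbove (Set.range G)) (hb : BddBelow (Set.range G))
    (h : (⨆ t, G t) - (⨅ t, G t) < δ) (t : ℝ) : |G t| < δ := by
  have h1 := le_ciSup ha t
  have h2 := ciInf_le hb t
  have h3 := le_ciSup ha 0
  have h4 := ciInf_le hb 0
  rw [h0] at h3 h4
  rw [abs_lt]
  constructor <;> linarith

section Kirchhoff

variable {n : ℕ}

/-- The Kirchhoff energy whose gradient is `-(a ∑ |x_h - x_{h-1}|² + b) (x_{k+1} - 2 x_k + x_{k-1})`. -/
noncomputable def kirchhoffEnergy (a b : ℝ) (x : EuclideanSpace ℝ (Fin n)) : ℝ :=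
  a / 4 * dirichletEnergy x ^ 2 + b / 2 * dirichletEnergy x

theorem continuous_kirchhoffEnergy (a b : ℝ) : Continuous (kirchhoffEnergy (n := n) a b) := by
  have := continuous_dirichletEnergy (n := n)
  unfold kirchhoffEnergy; fun_prop

theorem kirchhoffEnergy_eq {a : ℝ} (ha : a ≠ 0) (b : ℝ) (x : EuclideanSpace ℝ (Fin n)) :
    kirchhoffEnergy a b x =
      a / 4 * (dirichletEnergy x + b / a) ^ 2 - b ^ 2 / (4 * a) := by
  unfold kirchhoffEnergy; field_simp; ring

theorem hasGradientAt_kirchhoffEnergy_sub_sum (a b : ℝ) {h H : Fin n → ℝ → ℝ}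
    (hH : ∀ k t, HasDerivAt (H k) (h k t) t) (x : EuclideanSpace ℝ (Fin n)) :
    HasGradientAt (fun x => kirchhoffEnergy a b x - ∑ k, H k (x k))
      (WithLp.toLp 2 fun k =>
        -((a * dirichletEnergy x + b) * discreteLaplacian x k) - h k (x k)) x := by
  have hS := (hasGradientAt_dirichletEnergy x).hasFDerivAt
  have hsum : HasFDerivAt (fun x : EuclideanSpace ℝ (Fin n) => ∑ k, H k (x k))
      (∑ k, h k (x k) • (EuclideanSpace.proj k : EuclideanSpace ℝ (Fin n) →L[ℝ] ℝ)) x :=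
    HasFDerivAt.fun_sum fun k _ => (hH k (x k)).comp_hasFDerivAt x
      (EuclideanSpace.proj (𝕜 := ℝ) k).hasFDerivAt
  refine hasGradientAt_iff_hasFDerivAt.2
    ((((hS.pow 2).const_mul (a / 4)).add (hS.const_mul (b / 2))).sub hsum |>.congr_fderiv ?_)
  ext1 v
  simp only [_root_.sum_apply, _root_.smul_apply, _root_.sub_apply, _root_.add_apply, smul_eq_mul,
    toDual_apply_apply, PiLp.inner_apply, RCLike.inner_apply, conj_trivial, Finset.mul_sum,
    PiLp.proj_apply, ← Finset.sum_add_distrib, ← Finset.sum_sub_distrib]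
  refine Finset.sum_congr rfl fun k _ => ?_
  simp
  ring

theorem tendsto_kirchhoffEnergy_sub {a : ℝ} (ha : 0 < a) (b D C : ℝ) :
    Tendsto (fun x : EuclideanSpace ℝ (Fin n) =>
      kirchhoffEnergy a b x - D * dirichletEnergy x - C) (cocompact _) atTop := by
  refine (tendsto_dirichletEnergy.quadratic_atTop (show 0 < a / 4 by positivity)
    (b / 2 - D) C).congr fun x => ?_
  unfold kirchhoffEnergy; ring

theorem exists_dirichletEnergy_eq (hn : 1 ≤ n) {s : ℝ} (hs : 0 ≤ s) :
    ∃ x : EuclideanSpace ℝ (Fin n), dirichletEnergy x = s := by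
  set e : EuclideanSpace ℝ (Fin n) := EuclideanSpace.single ⟨0, hn⟩ 1 with he
  have hpos : 0 < dirichletEnergy e := by
    have := sq_apply_le_dirichletEnergy e ⟨0, hn⟩
    rw [he, PiLp.single_apply, if_pos rfl, ← he] at this
    by_contra! h
    nlinarith [sq_nonneg ((n : ℝ) + 1)]
  refine ⟨√(s / dirichletEnergy e) • e, ?_⟩
  rw [dirichletEnergy_smul, Real.sq_sqrt (by positivity), div_mul_cancel₀ _ hpos.ne']

/-- Penalising the Kirchhoff energy by terms vanishing only at the origin raises its infimum
`-b² / (4 a)`. -/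
theorem exists_gap_kirchhoffEnergy {a b ρ : ℝ} (ha : 0 < a) (hb : b < 0) (hρ : 0 < ρ)
    {F : Fin n → ℝ → ℝ} (hF : ∀ k, Continuous (F k)) (hF0 : ∀ k t, F k t = 0 → t = 0) :
    ∃ ε > 0, ∀ x : EuclideanSpace ℝ (Fin n),
      -(b ^ 2 / (4 * a)) + ε ≤ kirchhoffEnergy a b x + ρ * ∑ k, |F k (x k)| := by
  have hΦ := continuous_kirchhoffEnergy (n := n) a b
  have hnonneg : ∀ x : EuclideanSpace ℝ (Fin n), 0 ≤ ∑ k, |F k (x k)| := fun x =>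
    Finset.sum_nonneg fun _ _ => abs_nonneg _
  obtain ⟨x, hx⟩ := Continuous.exists_forall_le
    (f := fun x : EuclideanSpace ℝ (Fin n) => kirchhoffEnergy a b x + ρ * ∑ k, |F k (x k)|)
    (by fun_prop) (tendsto_atTop_mono (fun x => by
      simpa using mul_nonneg hρ.le (hnonneg x)) (tendsto_kirchhoffEnergy_sub ha b 0 0))
  refine ⟨kirchhoffEnergy a b x + ρ * ∑ k, |F k (x k)| + b ^ 2 / (4 * a), ?_, fun y => ?_⟩
  swap
  · linarith [hx y]
  have hsq : 0 ≤ a / 4 * (dirichletEnergy x + b / a) ^ 2 := by positivity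
  have hρF := mul_nonneg hρ.le (hnonneg x)
  rw [kirchhoffEnergy_eq ha.ne']
  by_contra! h
  have hsum : ∑ k, |F k (x k)| = 0 := by
    have : ρ * ∑ k, |F k (x k)| = 0 := by linarith
    simpa [hρ.ne'] using this
  have hx0 : x = 0 := by
    ext k
    refine hF0 k _ (abs_eq_zero.1 ?_)
    exact (Finset.sum_eq_zero_iff_of_nonneg fun _ _ => abs_nonneg _).1 hsum k (Finset.mem_univ k)
  have hS0 : dirichletEnergy x = 0 := by simp [hx0, dirichletEnergy]
  rw [hS0] at h
  have : 0 < a / 4 * (0 + b / a) ^ 2 := by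
    have : b / a ≠ 0 := div_ne_zero hb.ne ha.ne'
    rw [zero_add]; positivity
  linarith

theorem exists_three_critical_points {a b ρ ε δ : ℝ} (ha : 0 < a) (hb : b < 0) (hρ : 0 < ρ)
    (hn : 1 ≤ n) {f F g G : Fin n → ℝ → ℝ} (hf : ∀ k, Continuous (f k))
    (hg : ∀ k, Continuous (g k)) (hF : ∀ k t, HasDerivAt (F k) (f k t) t)
    (hG : ∀ k t, HasDerivAt (G k) (g k t) t) (hodd : ∀ k t, F k (-t) = -F k t)
    (hgrowth : ∀ k, ∃ C, 0 ≤ C ∧ ∀ t, |F k t| ≤ C * (t ^ 2 + 1))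
    (hgap : ∀ x : EuclideanSpace ℝ (Fin n),
      -(b ^ 2 / (4 * a)) + ε ≤ kirchhoffEnergy a b x + ρ * ∑ k, |F k (x k)|)
    (hGδ : ∀ k t, |G k t| ≤ δ) (hδ : 2 * n * δ < ε) :
    ∃ μ : Fin n → ℝ, (∀ k, |μ k| ≤ ρ) ∧ ∃ x₁ x₂ x₃ : EuclideanSpace ℝ (Fin n),
      x₁ ≠ x₂ ∧ x₁ ≠ x₃ ∧ x₂ ≠ x₃ ∧ ∀ x ∈ ({x₁, x₂, x₃} : Set (EuclideanSpace ℝ (Fin n))),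
        ∀ k, -((a * dirichletEnergy x + b) * discreteLaplacian x k) =
          g k (x k) + μ k * f k (x k) := by
  have hFc : ∀ k, Continuous (F k) := fun k =>
    continuous_iff_continuousAt.2 fun t => (hF k t).continuousAt
  have hGc : ∀ k, Continuous (G k) := fun k =>
    continuous_iff_continuousAt.2 fun t => (hG k t).continuousAt
  have hΦ := continuous_kirchhoffEnergy (n := n) a b
  choose C hC hFC using hgrowth
  have hsumG : ∀ x : EuclideanSpace ℝ (Fin n), |∑ k, G k (x k)| ≤ n * δ := fun x => by
    refine (Finset.abs_sum_le_sum_abs _ _).trans ((Finset.sum_le_sum fun k _ =>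
      hGδ k (x k)).trans_eq ?_)
    simp
  have hsumF : ∀ μ : Fin n → ℝ, (∀ k, |μ k| ≤ ρ) → ∀ x : EuclideanSpace ℝ (Fin n),
      ∑ k, μ k * F k (x k) ≤
        ρ * (∑ k, C k) * (((n : ℝ) + 1) ^ 2 * dirichletEnergy x + 1) := fun μ hμ x => by
    rw [Finset.mul_sum, Finset.sum_mul]
    refine Finset.sum_le_sum fun k _ => (le_abs_self _).trans ?_
    rw [abs_mul, mul_assoc]
    have hx := sq_apply_le_dirichletEnergy x k
    have := hC k
    have h : |F k (x k)| ≤ C k * (((n : ℝ) + 1) ^ 2 * dirichletEnergy x + 1) :=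
      (hFC k (x k)).trans (by gcongr)
    exact mul_le_mul (hμ k) h (abs_nonneg _) hρ.le
  have hΨ := tendsto_kirchhoffEnergy_sub (n := n) ha b (ρ * (∑ k, C k) * ((n : ℝ) + 1) ^ 2)
    (n * δ + ρ * ∑ k, C k)
  have hΨle : ∀ μ : Fin n → ℝ, (∀ k, |μ k| ≤ ρ) → ∀ x : EuclideanSpace ℝ (Fin n),
      kirchhoffEnergy a b x - ρ * (∑ k, C k) * ((n : ℝ) + 1) ^ 2 * dirichletEnergy x -
          (n * δ + ρ * ∑ k, C k) ≤
        kirchhoffEnergy a b x - ∑ k, G k (x k) - ∑ k, μ k * F k (x k) := fun μ hμ x => by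
    linarith [hsumF μ hμ x, (abs_le.1 (hsumG x)).2]
  obtain ⟨μ, hμ, x₁, x₂, hne, h₁, h₂⟩ := exists_two_minimizers_of_minimax_gap
    (I := fun x : EuclideanSpace ℝ (Fin n) => kirchhoffEnergy a b x - ∑ k, G k (x k))
    (F := fun k x => F k (x k)) (c := -(b ^ 2 / (4 * a)) + ε - n * δ)
    (by fun_prop) (fun k => by fun_prop) hρ.le hΨ hΨle
    (fun x => by linarith [hgap x, (abs_le.1 (hsumG x)).2])
    (fun μ hμ => by
      obtain ⟨x, hx⟩ := exists_dirichletEnergy_eq hn (s := -b / a)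
        (div_nonneg (by linarith) ha.le)
      have hneg : dirichletEnergy (-x) = -b / a := by
        rw [← hx, ← neg_one_smul ℝ x, dirichletEnergy_smul]; norm_num
      have hmin : ∀ y : EuclideanSpace ℝ (Fin n), dirichletEnergy y = -b / a →
          kirchhoffEnergy a b y = -(b ^ 2 / (4 * a)) := fun y hy => by
        rw [kirchhoffEnergy_eq ha.ne', hy]; ring
      have hoddsum : ∑ k, μ k * F k ((-x) k) = -∑ k, μ k * F k (x k) := by
        rw [← Finset.sum_neg_distrib]
        exact Finset.sum_congr rfl fun k _ => by rw [PiLp.neg_apply, hodd]; ring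
      rcases le_total 0 (∑ k, μ k * F k (x k)) with h | h
      · exact ⟨x, by linarith [hmin x hx, (abs_le.1 (hsumG x)).1]⟩
      · exact ⟨-x, by linarith [hmin (-x) hneg, (abs_le.1 (hsumG (-x))).1]⟩)
  refine ⟨μ, hμ, x₁, x₂, ?_⟩
  have hJeq : (fun x : EuclideanSpace ℝ (Fin n) => kirchhoffEnergy a b x -
      ∑ k, G k (x k) - ∑ k, μ k * F k (x k)) =
      fun x => kirchhoffEnergy a b x - ∑ k, (G k (x k) + μ k * F k (x k)) := by
    funext x; rw [Finset.sum_add_distrib]; ring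
  have hJ := hasGradientAt_kirchhoffEnergy_sub_sum a b
    (H := fun k t => G k t + μ k * F k t) fun k t => (hG k t).add ((hF k t).const_mul (μ k))
  rw [← hJeq] at hJ
  have hS := continuous_dirichletEnergy (n := n)
  have hΔ := continuous_discreteLaplacian (n := n)
  have hgrad : ∀ x : EuclideanSpace ℝ (Fin n), (WithLp.toLp 2 fun k =>
      -((a * dirichletEnergy x + b) * discreteLaplacian x k) - (g k (x k) + μ k * f k (x k))) =
        (0 : EuclideanSpace ℝ (Fin n)) →
      ∀ k, -((a * dirichletEnergy x + b) * discreteLaplacian x k) =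
        g k (x k) + μ k * f k (x k) := fun x hx k =>
    sub_eq_zero.1 (congrArg (fun v : EuclideanSpace ℝ (Fin n) => v k) hx)
  have hcrit : ∀ x : EuclideanSpace ℝ (Fin n), (∀ y : EuclideanSpace ℝ (Fin n),
      kirchhoffEnergy a b x - ∑ k, G k (x k) - ∑ k, μ k * F k (x k) ≤
        kirchhoffEnergy a b y - ∑ k, G k (y k) - ∑ k, μ k * F k (y k)) →
      ∀ k, -((a * dirichletEnergy x + b) * discreteLaplacian x k) =
        g k (x k) + μ k * f k (x k) := fun x hx => hgrad x <| by
    simpa using IsLocalMin.hasFDerivAt_eq_zero (Eventually.of_forall hx) (hJ x).hasFDerivAt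
  obtain ⟨x₃, h₃₁, h₃₂, h₃⟩ := exists_third_critical_point hJ (by fun_prop)
    (tendsto_atTop_mono (hΨle μ hμ) hΨ) hne h₁ h₂
  refine ⟨x₃, hne, h₃₁.symm, h₃₂.symm, ?_⟩
  rintro x (rfl | rfl | rfl)
  exacts [hcrit x h₁, hcrit x h₂, hgrad x h₃]

end Kirchhoff

/-- **Corollary 2.1.** Let `f₁,…,f_n : ℝ → ℝ` be continuous with
(b) `limsup_{|t|→+∞} |∫₀ᵗ f_k|/t² < +∞` and (c) `t ↦ ∫₀ᵗ f_k` odd, vanishing only at `0`.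
Then for each `a > 0`, `r > 0` and `b < 0` there is `δ > 0` such that for every `n`-tuple of
continuous functions `g₁,…,g_n` with `max_k (sup ∫₀ᵗ g_k − inf ∫₀ᵗ g_k) < δ` there exists
`μ ∈ ℝⁿ` with `Σ|μ_k|² < r²` such that the problem
`−(a Σ|x_h−x_{h−1}|² + b)(x_{k+1}−2x_k+x_{k−1}) = g_k(x_k) + μ_k f_k(x_k)`, `x₀ = x_{n+1} = 0`,
has at least three solutions. -/
theorem ricceri_corollary (n : ℕ) (hn : 1 ≤ n) (f : Fin n → ℝ → ℝ)
    (hf : ∀ k, Continuous (f k))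
    (hb : ∀ k, Filter.limsup
      (fun t : ℝ => ((|∫ s in (0 : ℝ)..t, f k s| / t ^ 2 : ℝ) : EReal)) (atBot ⊔ atTop) < ⊤)
    (hodd : ∀ k, ∀ t : ℝ, (∫ s in (0 : ℝ)..(-t), f k s) = -∫ s in (0 : ℝ)..t, f k s)
    (hvan : ∀ k, ∀ t : ℝ, (∫ s in (0 : ℝ)..t, f k s) = 0 → t = 0) :
    ∀ a > (0 : ℝ), ∀ r > (0 : ℝ), ∀ b < (0 : ℝ),
      ∃ δ > (0 : ℝ), ∀ g : Fin n → ℝ → ℝ, (∀ k, Continuous (g k)) →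
        (∀ k, BddAbove (Set.range fun t : ℝ => ∫ s in (0 : ℝ)..t, g k s)) →
        (∀ k, BddBelow (Set.range fun t : ℝ => ∫ s in (0 : ℝ)..t, g k s)) →
        (∀ k, (⨆ t : ℝ, ∫ s in (0 : ℝ)..t, g k s) - (⨅ t : ℝ, ∫ s in (0 : ℝ)..t, g k s) < δ) →
        ∃ μ : Fin n → ℝ, (∑ k, |μ k| ^ 2 < r ^ 2) ∧
          ∃ x₁ x₂ x₃ : Fin (n + 2) → ℝ, x₁ ≠ x₂ ∧ x₁ ≠ x₃ ∧ x₂ ≠ x₃ ∧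
            ∀ x ∈ ({x₁, x₂, x₃} : Set (Fin (n + 2) → ℝ)),
              x 0 = 0 ∧ x (Fin.last (n + 1)) = 0 ∧
              ∀ k : Fin n,
                -((a * (∑ h : Fin (n + 1), |x h.succ - x h.castSucc| ^ 2) + b) *
                    (x k.succ.succ - 2 * x k.succ.castSucc + x k.castSucc.castSucc)) =
                  g k (x k.succ.castSucc) + μ k * f k (x k.succ.castSucc) := by
  intro a ha r hr b hb'
  have hF : ∀ k t, HasDerivAt (fun t => ∫ s in (0 : ℝ)..t, f k s) (f k t) t := fun k t =>
    ((hf k).integral_hasStrictDerivAt 0 t).hasDerivAt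
  have hFc : ∀ k, Continuous fun t => ∫ s in (0 : ℝ)..t, f k s := fun k =>
    continuous_iff_continuousAt.2 fun t => (hF k t).continuousAt
  have hρ : 0 < r / (n + 1) := by positivity
  obtain ⟨ε, hε, hgap⟩ := exists_gap_kirchhoffEnergy ha hb' hρ hFc hvan
  refine ⟨ε / (2 * n + 1), by positivity, fun g hg hga hgb hgδ => ?_⟩
  obtain ⟨μ, hμ, x₁, x₂, x₃, h₁₂, h₁₃, h₂₃, hsol⟩ := exists_three_critical_points ha hb' hρ hn hf hg
    hF (fun k t => ((hg k).integral_hasStrictDerivAt 0 t).hasDerivAt) hodd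
    (fun k => exists_abs_le_mul_sq_add_one (hFc k) (hb k)) hgap
    (fun k t => (abs_lt_of_iSup_sub_iInf_lt (by simp) (hga k) (hgb k) (hgδ k) t).le)
    (by rw [mul_div_assoc', div_lt_iff₀ (by positivity)]; linarith)
  refine ⟨μ, ?_, fun j => zeroExtend j x₁, fun j => zeroExtend j x₂, fun j => zeroExtend j x₃, ?_⟩
  · calc ∑ k, |μ k| ^ 2 ≤ ∑ _k : Fin n, (r / (n + 1)) ^ 2 :=
        Finset.sum_le_sum fun k _ => pow_le_pow_left₀ (abs_nonneg _) (hμ k) 2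
      _ = n * (r / (n + 1)) ^ 2 := by simp
      _ < r ^ 2 := by
        rw [div_pow, mul_div_assoc', div_lt_iff₀ (by positivity), mul_comm]
        gcongr
        nlinarith [(Nat.cast_nonneg n : (0 : ℝ) ≤ n)]
  have hinj : ∀ x y : EuclideanSpace ℝ (Fin n), x ≠ y →
      (fun j => zeroExtend j x) ≠ fun j => zeroExtend j y := fun x y hxy h => hxy <| by
    ext k
    simpa using congrFun h k.castSucc.succ
  refine ⟨hinj _ _ h₁₂, hinj _ _ h₁₃, hinj _ _ h₂₃, ?_⟩
  have hall : ∀ x ∈ ({x₁, x₂, x₃} : Set (EuclideanSpace ℝ (Fin n))),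
      zeroExtend 0 x = 0 ∧ zeroExtend (Fin.last (n + 1)) x = 0 ∧ ∀ k : Fin n,
        -((a * (∑ h : Fin (n + 1), |zeroExtend h.succ x - zeroExtend h.castSucc x| ^ 2) + b) *
            (zeroExtend k.succ.succ x - 2 * zeroExtend k.succ.castSucc x +
              zeroExtend k.castSucc.castSucc x)) =
          g k (zeroExtend k.succ.castSucc x) + μ k * f k (zeroExtend k.succ.castSucc x) :=
    fun x hx => ⟨zeroExtend_zero x, zeroExtend_last x, fun k => by
      have := hsol x hx k
      simp only [sq_abs]
      rwa [← dirichletEnergy, ← discreteLaplacian, zeroExtend_succ_castSucc]⟩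
  rintro _ (rfl | rfl | rfl)
  exacts [hall x₁ (by simp), hall x₂ (by simp), hall x₃ (by simp)]
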